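/- Let R be a commutative Noetherian ring of finite Krull dimension d and let I be an ideal of R. Then the Krull dimension of the Rees algebra R[It] is at most d + 1. Moreover, if I is not contained in any minimal prime ideal of R, then the Krull dimension of R[It] equals d + 1. -/

import Mathlib

open Polynomial in
/-- Adjoining one algebraic element to a Noetherian domain does not increase the dimension. -/
theorem ringKrullDim_range_aeval_le_of_isAlgebraic {A B : Type*} [CommRing A]
    [IsNoetherianRing A] [IsDomain A] [CommRing B] [Algebra A B] {x : B} (hx : IsAlgebraic A x) :
    ringKrullDim (aeval (R := A) x).range ≤ ringKrullDim A := by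
  obtain ⟨p, hp, hpx⟩ := hx
  have h := ringKrullDim_succ_le_of_surjective (aeval (R := A) x).rangeRestrict.toRingHom
    (aeval (R := A) x).rangeRestrict_surjective (mem_nonZeroDivisors_of_ne_zero hp)
    (Subtype.ext hpx)
  rw [ringKrullDim_of_isNoetherianRing] at h
  exact (ENat.WithBot.add_le_add_one_right_iff).mp h

/-- Adjoining finitely many algebraic elements to a Noetherian domain does not increase the
dimension. -/
theorem ringKrullDim_adjoin_le_of_isAlgebraic {A B : Type*} [CommRing A] [IsNoetherianRing A]
    [CommRing B] [IsDomain B] [Algebra A B] [FaithfulSMul A B] {s : Set B} (hs : s.Finite)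
    (h : ∀ x ∈ s, IsAlgebraic A x) :
    ringKrullDim (Algebra.adjoin A s) ≤ ringKrullDim A := by
  induction s, hs using Set.Finite.induction_on with
  | empty =>
    rw [Algebra.adjoin_empty]
    exact ringKrullDim_le_of_surjective (algebraMap A (⊥ : Subalgebra A B))
      fun ⟨_, y, hy⟩ ↦ ⟨y, Subtype.ext hy⟩
  | @insert x s _ hs ih =>
    have : IsNoetherianRing (Algebra.adjoin A s) :=
      isNoetherianRing_of_fg (Subalgebra.fg_def.mpr ⟨s, hs, rfl⟩)
    refine le_trans ?_ (ih fun y hy ↦ h y (Set.mem_insert_of_mem x hy))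
    rw [← Set.union_singleton, Algebra.adjoin_union_eq_adjoin_adjoin,
      Algebra.adjoin_singleton_eq_range_aeval]
    exact ringKrullDim_range_aeval_le_of_isAlgebraic
      ((h x (Set.mem_insert x s)).extendScalars
        fun _ _ hab ↦ FaithfulSMul.algebraMap_injective A B (congrArg Subtype.val hab))

open Polynomial in
theorem ringKrullDim_adjoin_insert_le {R B : Type*} [CommRing R] [IsNoetherianRing R]
    [CommRing B] [IsDomain B] [Algebra R B] {y : B} {s : Set B} (hs : s.Finite)
    (h : ∀ x ∈ s, IsAlgebraic (aeval (R := R) y).range x) :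
    ringKrullDim (Algebra.adjoin R (insert y s)) ≤ ringKrullDim R + 1 := by
  rw [Set.insert_eq, Algebra.adjoin_union_eq_adjoin_adjoin,
    Algebra.adjoin_singleton_eq_range_aeval]
  refine (ringKrullDim_adjoin_le_of_isAlgebraic hs h).trans ?_
  rw [← ringKrullDim_of_isNoetherianRing]
  exact ringKrullDim_le_of_surjective (aeval (R := R) y).rangeRestrict.toRingHom
    (aeval (R := R) y).rangeRestrict_surjective

/-- Every chain of primes is at most as long as the dimension of the quotient by some minimal
prime. -/
theorem exists_minimalPrimes_length_le_ringKrullDim_quotient {R : Type*} [CommRing R]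
    (l : LTSeries (PrimeSpectrum R)) :
    ∃ p ∈ minimalPrimes R, (l.length : WithBot ℕ∞) ≤ ringKrullDim (R ⧸ p) := by
  obtain ⟨p, hp, hpl⟩ := Ideal.exists_minimalPrimes_le (J := l.head.asIdeal) bot_le
  refine ⟨p, hp, ?_⟩
  rw [ringKrullDim_quotient]
  exact Order.LTSeries.length_le_krullDim
    { l with
      toFun := fun i ↦ ⟨l i, hpl.trans (LTSeries.head_le l i)⟩
      step := l.step }

open Polynomial in
theorem reesAlgebra_eq_adjoin_image_monomial {R : Type*} [CommRing R] (s : Set R) :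
    reesAlgebra (Ideal.span s) = Algebra.adjoin R (monomial 1 '' s) := by
  rw [← adjoin_monomial_eq_reesAlgebra, Ideal.span, Submodule.map_span, Algebra.adjoin_span]

open Polynomial in
theorem reesAlgebra_map_ringKrullDim_le {R B : Type*} [CommRing R] [IsNoetherianRing R]
    [CommRing B] [IsDomain B] (I : Ideal R) [Algebra R B] (f : R[X] →ₐ[R] B) :
    ringKrullDim ((reesAlgebra I).map f) ≤ ringKrullDim R + 1 := by
  obtain ⟨s, rfl⟩ := IsNoetherian.noetherian I
  change ringKrullDim ((reesAlgebra (Ideal.span (s : Set R))).map f) ≤ _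
  rw [reesAlgebra_eq_adjoin_image_monomial, AlgHom.map_adjoin]
  set T : Set B := f '' (monomial 1 '' (s : Set R))
  have hfin : T.Finite := (s.finite_toSet.image _).image _
  have hmon (b : R) : f (monomial 1 b) = algebraMap R B b * f X := by
    rw [← C_mul_X_eq_monomial, map_mul, ← algebraMap_eq, AlgHom.commutes]
  obtain ⟨y, hy, halg⟩ : ∃ y ∈ Algebra.adjoin R T,
      ∀ x ∈ T, IsAlgebraic (aeval (R := R) y).range x := by
    by_cases h : ∀ b ∈ s, algebraMap R B b = 0
    · refine ⟨0, zero_mem _, ?_⟩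
      rintro _ ⟨_, ⟨b, hb, rfl⟩, rfl⟩
      rw [hmon, h b hb, zero_mul]
      exact isAlgebraic_zero
    · push Not at h
      obtain ⟨a, ha, ha0⟩ := h
      refine ⟨f (monomial 1 a), Algebra.subset_adjoin ⟨_, ⟨a, ha, rfl⟩, rfl⟩, ?_⟩
      rintro _ ⟨_, ⟨b, hb, rfl⟩, rfl⟩
      let A := (aeval (R := R) (f (monomial 1 a))).range
      let y : A := ⟨f (monomial 1 a), X, aeval_X _⟩
      refine ⟨C (algebraMap R A a) * X - C (algebraMap R A b * y), fun h0 ↦ ha0 ?_, ?_⟩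
      · have := congrArg (fun q ↦ algebraMap A B (q.coeff 1)) h0
        simpa [coeff_C, ← IsScalarTower.algebraMap_apply] using this
      · have hy : algebraMap A B y = f (monomial 1 a) := rfl
        have hA (r : R) : algebraMap A B (algebraMap R A r) = algebraMap R B r := rfl
        simp only [map_sub, map_mul, aeval_C, aeval_X]
        rw [hy, hA, hA, hmon, hmon]
        ring
  have hins : Algebra.adjoin R T = Algebra.adjoin R (insert y T) :=
    le_antisymm (Algebra.adjoin_mono (Set.subset_insert _ _))
      (Algebra.adjoin_le (Set.insert_subset hy Algebra.subset_adjoin))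
  rw [hins]
  exact ringKrullDim_adjoin_insert_le hfin halg

open Polynomial in
theorem ringKrullDim_reesAlgebra_quotient_le {R : Type*} [CommRing R] [IsNoetherianRing R]
    (I : Ideal R) {P : Ideal (reesAlgebra I)} (hP : P ∈ minimalPrimes (reesAlgebra I)) :
    ringKrullDim (reesAlgebra I ⧸ P) ≤ ringKrullDim R + 1 := by
  obtain ⟨Q, hQ, rfl⟩ := Ideal.exists_comap_eq_of_mem_minimalPrimes_of_injective
    (f := (reesAlgebra I).val.toRingHom) Subtype.val_injective P hP
  refine le_trans ?_ (reesAlgebra_map_ringKrullDim_le I (Ideal.Quotient.mkₐ R Q))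
  let g : reesAlgebra I →+* R[X] ⧸ Q := (Ideal.Quotient.mk Q).comp (reesAlgebra I).val.toRingHom
  have hg : RingHom.ker g = Q.comap (reesAlgebra I).val.toRingHom := by
    rw [← RingHom.comap_ker, Ideal.mk_ker]
  rw [← hg, ringKrullDim_eq_of_ringEquiv g.quotientKerEquivRange]
  refine (ringKrullDim_eq_of_ringEquiv (RingEquiv.subringCongr ?_ :
    g.range ≃+* ((reesAlgebra I).map (Ideal.Quotient.mkₐ R Q)).toSubring)).le
  ext z
  simp [g]

open Polynomial in
/-- The quotient of `R` by a minimal prime not containing `I` contributes one more dimension to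
the Rees algebra. -/
theorem ringKrullDim_quotient_succ_le_reesAlgebra {R : Type*} [CommRing R] (I p : Ideal R)
    [p.IsPrime] (h : ¬ I ≤ p) :
    ringKrullDim (R ⧸ p) + 1 ≤ ringKrullDim (reesAlgebra I) := by
  obtain ⟨a, haI, hap⟩ := Set.not_subset.mp h
  let φ : reesAlgebra I →+* (R ⧸ p)[X] :=
    (mapRingHom (Ideal.Quotient.mk p)).comp (reesAlgebra I).val.toRingHom
  let ψ : φ.range →+* R ⧸ p := constantCoeff.comp φ.range.subtype
  have hψ : Function.Surjective ψ := by
    intro z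
    obtain ⟨r, rfl⟩ := Ideal.Quotient.mk_surjective z
    refine ⟨⟨_, algebraMap R (reesAlgebra I) r, rfl⟩, ?_⟩
    change (φ (algebraMap R (reesAlgebra I) r)).coeff 0 = _
    simp [φ]
  let m : reesAlgebra I := ⟨monomial 1 a, reesAlgebra.monomial_mem.mpr (by simpa using haI)⟩
  refine (ringKrullDim_succ_le_of_surjective ψ hψ (r := ⟨φ m, m, rfl⟩) ?_ ?_).trans
    (ringKrullDim_le_of_surjective φ.rangeRestrict φ.rangeRestrict_surjective)
  · refine mem_nonZeroDivisors_of_ne_zero fun h0 ↦ hap ?_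
    have := congrArg (fun q ↦ q.val.coeff 1) h0
    simpa [φ, m, Ideal.Quotient.eq_zero_iff_mem] using this
  · change (φ m).coeff 0 = 0
    simp [φ, m]

/-- Let `R` be a Noetherian ring of Krull dimension `d` and `I` an ideal.  Then the Rees
algebra `R[It]` has Krull dimension at most `d + 1`, with equality when `I` is not contained
in any minimal prime of `R`. -/
theorem reesAlgebra_krullDim {R : Type*} [CommRing R] [IsNoetherianRing R]
    (d : ℕ) (hdim : ringKrullDim R = d) (I : Ideal R) :
    ringKrullDim ↥(reesAlgebra I) ≤ (d + 1 : ℕ) ∧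
      ((∀ p ∈ minimalPrimes R, ¬ I ≤ p) → ringKrullDim ↥(reesAlgebra I) = (d + 1 : ℕ)) := by
  have upper : ringKrullDim ↥(reesAlgebra I) ≤ (d + 1 : ℕ) := by
    refine iSup_le fun l ↦ ?_
    obtain ⟨P, hP, hl⟩ := exists_minimalPrimes_length_le_ringKrullDim_quotient l
    refine hl.trans ((ringKrullDim_reesAlgebra_quotient_le I hP).trans ?_)
    simp [hdim]
  refine ⟨upper, fun hI ↦ upper.antisymm ?_⟩
  obtain ⟨l, hl⟩ := Order.le_krullDim_iff.mp hdim.ge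
  obtain ⟨p, hp, hlp⟩ := exists_minimalPrimes_length_le_ringKrullDim_quotient l
  have := hp.isPrime
  refine le_trans ?_ (ringKrullDim_quotient_succ_le_reesAlgebra I p (hI p hp))
  rw [← hl]
  push_cast
  gcongr
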